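/- Nonsingularity criterion: Let d ≥ 1 and let X be a d-dimensional combinatorial cell structure that is APC. Let T ⊆ X_d and S ⊆ X_{d−1} with |T| = |S| = |X_d| − β_d(X), and let ∂_{S,T} be the square submatrix of ∂_d with rows indexed by S and columns indexed by T. Then det ∂_{S,T} ≠ 0 if and only if both of the following hold: T is a cellular spanning d-tree of X, and the complement S̄ = X_{d−1} ∖ S is the set of (d−1)-cells of a cellular spanning (d−1)-tree of X. -/

import Mathlib

open BigOperators Matrix

/-- A `d`-dimensional combinatorial cell structure: nonempty finite sets of `i`-cells
(of sizes `c i`, with `c i = 0` for `i > d`) together with integer boundary matrices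
`D i` (the matrix of `∂_{i+1}`), satisfying `∂ ∘ ∂ = 0` and the condition that every
column of `∂_1 = D 0` sums to zero. -/
structure CellStructure (d : ℕ) where
  c : ℕ → ℕ
  c_pos : ∀ i, i ≤ d → 0 < c i
  c_zero : ∀ i, d < i → c i = 0
  D : (i : ℕ) → Matrix (Fin (c i)) (Fin (c (i + 1))) ℤ
  dd : ∀ i, D i * D (i + 1) = 0
  colsum : ∀ j, ∑ i, D 0 i j = 0

namespace CellStructure

variable {d : ℕ} (X : CellStructure d)

/-- The augmentation map `ε : ℤ^{X_0} → ℤ`. -/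
def aug : (Fin (X.c 0) → ℤ) →ₗ[ℤ] ℤ where
  toFun v := ∑ i, v i
  map_add' u v := by simp [Finset.sum_add_distrib]
  map_smul' r v := by simp [Finset.mul_sum]

/-- The rational augmentation map. -/
def augQ : (Fin (X.c 0) → ℚ) →ₗ[ℚ] ℚ where
  toFun v := ∑ i, v i
  map_add' u v := by simp [Finset.sum_add_distrib]
  map_smul' r v := by simp [Finset.mul_sum]

/-- `bdry i` is the boundary map `∂_{i+1} : C_{i+1} → C_i`. -/
def bdry (i : ℕ) : (Fin (X.c (i + 1)) → ℤ) →ₗ[ℤ] (Fin (X.c i) → ℤ) :=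
  Matrix.toLin' (X.D i)

/-- Reduced cycles: `Zker i = ker ∂_i` (with `∂_0 = ε` the augmentation). -/
def Zker : (i : ℕ) → Submodule ℤ (Fin (X.c i) → ℤ)
  | 0 => LinearMap.ker X.aug
  | (i + 1) => LinearMap.ker (X.bdry i)

/-- Rational reduced cycles: kernel of `∂_i ⊗ ℚ`. -/
def ZkerQ : (i : ℕ) → Submodule ℚ (Fin (X.c i) → ℚ)
  | 0 => LinearMap.ker X.augQ
  | (i + 1) => LinearMap.ker (Matrix.toLin' ((X.D i).map (Int.cast : ℤ → ℚ)))

/-- Reduced homology `H_i(X) = ker ∂_i / im ∂_{i+1}` for `i ≥ 0`. -/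
abbrev H (i : ℕ) : Type :=
  X.Zker i ⧸ (LinearMap.range (X.bdry i)).comap (X.Zker i).subtype

/-- `Hred j` is the reduced homology in dimension `j - 1`; in particular
`Hred 0 = H_{-1}(X) = ℤ / im ε`. -/
def Hred : ℕ → Type
  | 0 => ℤ ⧸ LinearMap.range X.aug
  | (i + 1) => X.H i

/-- `β_i(X)`, the rank of the `i`-th reduced homology group. -/
noncomputable def beta (i : ℕ) : ℕ := Module.finrank ℤ (X.H i)

/-- `X` is acyclic in positive codimension. -/
def APC : Prop := ∀ i, i < d → X.beta i = 0

/-- The span of the columns of `∂_{j+1}` indexed by `T`. -/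
def colSpan (j : ℕ) (T : Finset (Fin (X.c (j + 1)))) : Submodule ℤ (Fin (X.c j) → ℤ) :=
  Submodule.span ℤ ((fun t => (X.D j)ᵀ t) '' (T : Set (Fin (X.c (j + 1)))))

/-- For `T ⊆ X_{j+1}`, the homology group `H_j(X_T)` of the subcomplex `X_T`. -/
abbrev Hsub (j : ℕ) (T : Finset (Fin (X.c (j + 1)))) : Type :=
  X.Zker j ⧸ (X.colSpan j T).comap (X.Zker j).subtype

/-- `HsubG k T` is `H_{k-1}(X_T)` for `T ⊆ X_k`; for `k = 0` this is
`H_{-1}(X_T) = ℤ / (ℤ-span of the entries of ε on T)` (all of which equal `1`). -/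
def HsubG : (k : ℕ) → Finset (Fin (X.c k)) → Type
  | 0, T => ℤ ⧸ Submodule.span ℤ ((fun _v => (1 : ℤ)) '' (T : Set (Fin (X.c 0))))
  | (j + 1), T => X.Hsub j T

/-- `T ⊆ X_{j+1}` is a cellular spanning `(j+1)`-tree of `X`. -/
def IsTree (j : ℕ) (T : Finset (Fin (X.c (j + 1)))) : Prop :=
  LinearIndependent ℤ (fun t : {f // f ∈ T} => (X.D j)ᵀ (t : Fin (X.c (j + 1))))
    ∧ Nat.card (X.Hsub j T) ≠ 0
    ∧ T.card = Module.finrank ℚ (X.ZkerQ j)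

/-- `IsTreeG k T` : `T ⊆ X_k` is a cellular spanning `k`-tree of `X`; a spanning
`0`-tree is a single vertex. -/
def IsTreeG : (k : ℕ) → Finset (Fin (X.c k)) → Prop
  | 0, T => LinearIndependent ℤ (fun _t : {f // f ∈ T} => (1 : ℤ))
      ∧ Nat.card (ℤ ⧸ Submodule.span ℤ ((fun _v => (1 : ℤ)) '' (T : Set (Fin (X.c 0))))) ≠ 0
      ∧ T.card = 1
  | (j + 1), T => X.IsTree j T

open Classical in
/-- The torsion-weighted spanning tree enumerators `τ_k(X)`, with `τ_0(X) = |X_0|`. -/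
noncomputable def tau : ℕ → ℕ
  | 0 => X.c 0
  | (j + 1) => ∑ T : Finset (Fin (X.c (j + 1))),
      if X.IsTree j T then (Nat.card (X.Hsub j T)) ^ 2 else 0

/-- The real boundary matrix of `∂_{i+1}`. -/
noncomputable def Dr (i : ℕ) : Matrix (Fin (X.c i)) (Fin (X.c (i + 1))) ℝ :=
  (X.D i).map (Int.cast : ℤ → ℝ)

/-- The up-down Laplacian `L^ud_i = ∂_{i+1} ∂_{i+1}^T` as a real matrix. -/
noncomputable def Lud (i : ℕ) : Matrix (Fin (X.c i)) (Fin (X.c i)) ℝ :=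
  X.Dr i * (X.Dr i)ᴴ

theorem Lud_isHermitian (i : ℕ) : (X.Lud i).IsHermitian :=
  Matrix.isHermitian_mul_conjTranspose_self _

/-- `π_k(X)`: the product of the nonzero eigenvalues of `L^ud_{k-1}` for `k ≥ 1`,
and `π_0(X) = |X_0|`. -/
noncomputable def piNZ : ℕ → ℝ
  | 0 => (X.c 0 : ℝ)
  | (j + 1) => ∏ i, (if (X.Lud_isHermitian j).eigenvalues i = 0 then 1
      else (X.Lud_isHermitian j).eigenvalues i)

end CellStructure

/-- A sum over `ι` of a function vanishing outside `T` is a sum over `T`. -/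
theorem sum_eq_sum_coe_of_forall_notMem {ι M : Type*} [Fintype ι] [DecidableEq ι] [AddCommGroup M]
    (T : Finset ι) (F : ι → M) (hF : ∀ i ∉ T, F i = 0) :
    ∑ i, F i = ∑ t : {f // f ∈ T}, F t := by
  rw [← Finset.sum_subset (Finset.subset_univ T) fun i _ hi => hF i hi]
  exact (Finset.sum_coe_sort T F).symm

namespace Matrix

variable {ι κ : Type*} [Fintype κ] [DecidableEq κ]

theorem linearIndependent_col_subset_iff (A : Matrix ι κ ℤ) (T : Finset κ) :
    LinearIndependent ℤ (fun t : {f // f ∈ T} => Aᵀ (t : κ)) ↔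
      ∀ v : κ → ℤ, (∀ j ∉ T, v j = 0) → A *ᵥ v = 0 → v = 0 := by
  have key (v : κ → ℤ) (hv : ∀ j ∉ T, v j = 0) :
      A *ᵥ v = ∑ t : {f // f ∈ T}, v t • Aᵀ (t : κ) := by
    rw [← sum_eq_sum_coe_of_forall_notMem T (fun j => v j • Aᵀ j) fun j hj => by simp [hv j hj]]
    ext i
    simp [mulVec, dotProduct, mul_comm]
  rw [Fintype.linearIndependent_iff]
  refine ⟨fun h v hv hAv => funext fun j => ?_, fun h g hg t => ?_⟩
  · by_cases hj : j ∈ T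
    · exact h (fun t => v t) ((key v hv).symm.trans hAv) ⟨j, hj⟩
    · exact hv j hj
  · let v : κ → ℤ := fun j => if hj : j ∈ T then g ⟨j, hj⟩ else 0
    have hv : ∀ j ∉ T, v j = 0 := fun j hj => dif_neg hj
    have hvg (t : {f // f ∈ T}) : v t = g t := dif_pos t.2
    have h0 : v = 0 := h v hv (by simpa [key v hv, hvg] using hg)
    rw [← hvg, h0, Pi.zero_apply]

theorem det_submatrix_ne_zero_iff {m : ℕ} (A : Matrix ι κ ℤ) (S : Finset ι) (T : Finset κ)
    (eS : Fin m ≃ {f // f ∈ S}) (eT : Fin m ≃ {f // f ∈ T}) :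
    det (of fun i j => A (eS i).1 (eT j).1) ≠ 0 ↔
      ∀ v : κ → ℤ, (∀ j ∉ T, v j = 0) → (∀ i ∈ S, (A *ᵥ v) i = 0) → v = 0 := by
  have key (v : κ → ℤ) (hv : ∀ j ∉ T, v j = 0) (i : Fin m) :
      (A *ᵥ v) (eS i) = ((of fun i j => A (eS i).1 (eT j).1) *ᵥ fun j => v (eT j)) i := by
    simp only [mulVec, dotProduct, of_apply]
    rw [sum_eq_sum_coe_of_forall_notMem T (fun j => A (eS i) j * v j) fun j hj => by simp [hv j hj]]
    exact (eT.sum_comp fun t => A (eS i) t * v t).symm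
  rw [Ne, ← exists_mulVec_eq_zero_iff]
  push Not
  refine ⟨fun h v hv hAv => funext fun j => ?_, fun h g hg hMg => hg (funext fun j => ?_)⟩
  · by_contra hj
    have hjT : j ∈ T := by_contra fun hjT => hj (hv j hjT)
    refine h (fun j => v (eT j)) (fun h0 => hj ?_) (funext fun i => ?_)
    · simpa using congrFun h0 (eT.symm ⟨j, hjT⟩)
    · rw [← key v hv]
      exact hAv _ (eS i).2
  · let v : κ → ℤ := fun j => if hj : j ∈ T then g (eT.symm ⟨j, hj⟩) else 0
    have hv : ∀ j ∉ T, v j = 0 := fun j hj => dif_neg hj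
    have hvg (j : Fin m) : v (eT j) = g j := (dif_pos (eT j).2).trans (by simp)
    have h0 : v = 0 := h v hv fun i hi => by
      have := key v hv (eS.symm ⟨i, hi⟩)
      simpa [hvg, hMg] using this
    rw [← hvg, h0, Pi.zero_apply, Pi.zero_apply]

end Matrix

theorem exists_int_smul_eq_intCast {ι : Type*} [Finite ι] (v : ι → ℚ) :
    ∃ (a : ℤ) (w : ι → ℤ), a ≠ 0 ∧ ∀ i, (a : ℚ) * v i = w i := by
  obtain ⟨b, hb⟩ := IsLocalization.exist_integer_multiples_of_finite (nonZeroDivisors ℤ) v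
  choose w hw using hb
  exact ⟨b, w, nonZeroDivisors.coe_ne_zero b, fun i => by simpa using (hw i).symm⟩

/-- A subspace of `ℚ^ι` has the same rank as the lattice of its integer points. -/
theorem finrank_integerPoints {ι : Type*} [Finite ι] (A : Submodule ℤ (ι → ℤ))
    (B : Submodule ℚ (ι → ℚ)) (h : ∀ v : ι → ℤ, v ∈ A ↔ (fun i => (v i : ℚ)) ∈ B) :
    Module.finrank ℚ B = Module.finrank ℤ A := by
  let f : A →ₗ[ℤ] B :=
    { toFun := fun v => ⟨fun i => (v.1 i : ℚ), (h v.1).1 v.2⟩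
      map_add' := fun u v => by ext; simp
      map_smul' := fun r v => by ext; simp }
  have : IsLocalizedModule (nonZeroDivisors ℤ) f := by
    refine ⟨fun a => ?_, fun y => ?_, fun {u v} huv => ⟨1, ?_⟩⟩
    · have ha : ((a : ℤ) : ℚ) ≠ 0 := by exact_mod_cast nonZeroDivisors.coe_ne_zero a
      rw [Module.End.isUnit_iff]
      refine ⟨fun x y hxy => ?_, fun y => ⟨((a : ℤ) : ℚ)⁻¹ • y, ?_⟩⟩
      · ext i
        have := congrFun (congrArg Subtype.val hxy) i
        simpa [ha] using this
      · ext i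
        simp [ha]
    · obtain ⟨a, w, ha, hw⟩ := exists_int_smul_eq_intCast y.1
      have hwB : (fun i => (w i : ℚ)) = (a : ℚ) • y.1 := funext fun i => (hw i).symm
      refine ⟨(⟨w, (h w).2 (hwB ▸ B.smul_mem _ y.2)⟩,
        ⟨a, mem_nonZeroDivisors_of_ne_zero ha⟩), ?_⟩
      ext i
      simpa [f, Submonoid.smul_def] using hw i
    · congr 1
      ext i
      have := congrFun (congrArg Subtype.val huv) i
      simpa [f] using this
  rw [← IsLocalizedModule.finrank_eq (nonZeroDivisors ℤ) f le_rfl,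
    IsLocalization.finrank_eq ℚ (nonZeroDivisors ℤ) le_rfl]

namespace CellStructure

variable {d : ℕ} (X : CellStructure d)

theorem finrank_ZkerQ (j : ℕ) :
    Module.finrank ℚ (X.ZkerQ j) = Module.finrank ℤ (X.Zker j) := by
  refine finrank_integerPoints _ _ fun v => ?_
  cases j with
  | zero =>
    change (∑ i, v i = 0) ↔ (∑ i, (v i : ℚ) = 0)
    exact_mod_cast Iff.rfl
  | succ j =>
    have hcast (i) : (((X.D j).map (Int.cast : ℤ → ℚ)) *ᵥ fun k => (v k : ℚ)) i =
        ((X.D j *ᵥ v) i : ℤ) := by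
      simp [mulVec, dotProduct]
    change (X.D j *ᵥ v = 0) ↔ (((X.D j).map (Int.cast : ℤ → ℚ)) *ᵥ fun k => (v k : ℚ)) = 0
    simp only [funext_iff, hcast, Pi.zero_apply, Int.cast_eq_zero]

theorem mulVec_mem_Zker (j : ℕ) (v : Fin (X.c (j + 1)) → ℤ) : X.D j *ᵥ v ∈ X.Zker j := by
  cases j with
  | zero =>
    change ∑ i, (X.D 0 *ᵥ v) i = 0
    simp only [mulVec, dotProduct]
    rw [Finset.sum_comm]
    simp [← Finset.sum_mul, X.colsum]
  | succ j =>
    change X.D j *ᵥ (X.D (j + 1) *ᵥ v) = 0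
    rw [mulVec_mulVec, X.dd, zero_mulVec]

theorem range_bdry_le_Zker (j : ℕ) : LinearMap.range (X.bdry j) ≤ X.Zker j := by
  rintro _ ⟨v, rfl⟩
  exact X.mulVec_mem_Zker j v

theorem exists_mulVec_eq_of_mem_colSpan {j : ℕ} {T : Finset (Fin (X.c (j + 1)))}
    {w : Fin (X.c j) → ℤ} (hw : w ∈ X.colSpan j T) :
    ∃ v : Fin (X.c (j + 1)) → ℤ, (∀ i ∉ T, v i = 0) ∧ X.D j *ᵥ v = w := by
  induction hw using Submodule.span_induction with
  | mem x hx =>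
    obtain ⟨t, ht, rfl⟩ := hx
    refine ⟨Pi.single t 1, fun i hi => Pi.single_eq_of_ne ?_ _, ?_⟩
    · rintro rfl
      exact hi ht
    · ext i
      simp
  | zero => exact ⟨0, fun _ _ => rfl, mulVec_zero _⟩
  | add x y _ _ hx hy =>
    obtain ⟨u, hu, rfl⟩ := hx
    obtain ⟨v, hv, rfl⟩ := hy
    exact ⟨u + v, fun i hi => by simp [hu i hi, hv i hi], mulVec_add _ _ _⟩
  | smul a x _ hx =>
    obtain ⟨u, hu, rfl⟩ := hx
    exact ⟨a • u, fun i hi => by simp [hu i hi], mulVec_smul _ _ _⟩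

theorem colSpan_le_Zker (j : ℕ) (T : Finset (Fin (X.c (j + 1)))) :
    X.colSpan j T ≤ X.Zker j := by
  intro w hw
  obtain ⟨v, -, rfl⟩ := X.exists_mulVec_eq_of_mem_colSpan hw
  exact X.mulVec_mem_Zker j v

theorem finrank_Zker_zero (hX : 0 < X.c 0) : Module.finrank ℤ (X.Zker 0) + 1 = X.c 0 := by
  have hr : LinearMap.range X.aug = ⊤ := by
    rw [LinearMap.range_eq_top]
    intro a
    exact ⟨Pi.single ⟨0, hX⟩ a, by simp [aug]⟩
  have h := (LinearMap.ker X.aug).finrank_quotient_add_finrank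
  rw [X.aug.quotKerEquivRange.finrank_eq, hr, finrank_top, Module.finrank_self,
    Module.finrank_fin_fun, add_comm] at h
  exact h

theorem finrank_Zker_succ (j : ℕ) :
    Module.finrank ℤ (LinearMap.range (X.bdry j)) + Module.finrank ℤ (X.Zker (j + 1)) =
      X.c (j + 1) := by
  have h := (LinearMap.ker (X.bdry j)).finrank_quotient_add_finrank
  rw [(X.bdry j).quotKerEquivRange.finrank_eq, Module.finrank_fin_fun] at h
  exact h

theorem beta_add_finrank_range (j : ℕ) :
    X.beta j + Module.finrank ℤ (LinearMap.range (X.bdry j)) = Module.finrank ℤ (X.Zker j) := by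
  rw [← (Submodule.comapSubtypeEquivOfLe (X.range_bdry_le_Zker j)).finrank_eq]
  exact Submodule.finrank_quotient_add_finrank _

theorem beta_top : X.beta d = Module.finrank ℤ (X.Zker d) := by
  have : IsEmpty (Fin (X.c (d + 1))) := by
    rw [X.c_zero (d + 1) d.lt_succ_self]
    infer_instance
  have hr : LinearMap.range (X.bdry d) = ⊥ := by
    rw [LinearMap.range_eq_bot]
    exact Subsingleton.elim _ _
  rw [← X.beta_add_finrank_range d, hr, finrank_bot, add_zero]

variable {X}

theorem APC.finrank_range (hX : X.APC) {j : ℕ} (hj : j < d) :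
    Module.finrank ℤ (LinearMap.range (X.bdry j)) = Module.finrank ℤ (X.Zker j) := by
  simpa [hX j hj] using X.beta_add_finrank_range j

theorem isTree_of_linearIndependent {j : ℕ} {T : Finset (Fin (X.c (j + 1)))}
    (hli : LinearIndependent ℤ (fun t : {f // f ∈ T} => (X.D j)ᵀ (t : Fin (X.c (j + 1)))))
    (hcard : T.card = Module.finrank ℤ (X.Zker j)) : X.IsTree j T := by
  refine ⟨hli, ?_, hcard.trans (X.finrank_ZkerQ j).symm⟩
  have hspan : Module.finrank ℤ (X.colSpan j T) = T.card := by
    have h := finrank_span_eq_card hli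
    rw [Fintype.card_coe] at h
    rw [← h, colSpan, Set.image_eq_range]
    rfl
  have : Finite (X.Hsub j T) := by
    refine Submodule.finiteQuotientOfFreeOfRankEq _ ?_
    rw [(Submodule.comapSubtypeEquivOfLe (X.colSpan_le_Zker j T)).finrank_eq, hspan, hcard]
  exact Nat.card_pos.ne'

/-- If `H_j(X_T)` is finite, every cycle has a nonzero multiple that is a boundary from `T`. -/
theorem exists_smul_mem_colSpan {j : ℕ} {T : Finset (Fin (X.c (j + 1)))}
    (hT : Nat.card (X.Hsub j T) ≠ 0) {w : Fin (X.c j) → ℤ} (hw : w ∈ X.Zker j) :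
    ∃ N : ℕ, N ≠ 0 ∧ N • w ∈ X.colSpan j T :=
  ⟨_, hT, AddSubgroup.nsmul_index_mem
    ((X.colSpan j T).comap (X.Zker j).subtype).toAddSubgroup ⟨w, hw⟩⟩

theorem IsTreeG.eq_zero_of_mem_Zker {j : ℕ} {R : Finset (Fin (X.c j))} (hR : X.IsTreeG j R)
    {w : Fin (X.c j) → ℤ} (hw : w ∈ X.Zker j) (hwR : ∀ i ∉ R, w i = 0) : w = 0 := by
  cases j with
  | zero =>
    obtain ⟨v, rfl⟩ := Finset.card_eq_one.1 hR.2.2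
    have hv (i) (hi : i ≠ v) : w i = 0 := hwR i (by simpa using hi)
    have hsum : ∑ i, w i = 0 := hw
    rw [Finset.sum_eq_single v (fun i _ hi => hv i hi) (by simp)] at hsum
    ext i
    by_cases hi : i = v
    · rw [hi, hsum, Pi.zero_apply]
    · exact hv i hi
  | succ j => exact (linearIndependent_col_subset_iff _ _).1 hR.1 w hwR hw

/-- For APC `X`, a set of `j`-cells of the right size that supports no nonzero cycle is a
spanning `j`-tree. -/
theorem APC.isTreeG_of_forall_eq_zero (hX : X.APC) {j : ℕ} (hj : j ≤ d)
    {R : Finset (Fin (X.c j))} (hcard : R.card + Module.finrank ℤ (X.Zker j) = X.c j)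
    (hR : ∀ w ∈ X.Zker j, (∀ i ∉ R, w i = 0) → w = 0) : X.IsTreeG j R := by
  cases j with
  | zero =>
    have h1 : R.card = 1 := by
      have := X.finrank_Zker_zero (X.c_pos 0 hj)
      omega
    obtain ⟨v, rfl⟩ := Finset.card_eq_one.1 h1
    refine ⟨?_, ?_, h1⟩
    · rw [Fintype.linearIndependent_iff]
      intro g hg t
      have : Subsingleton {f // f ∈ ({v} : Finset (Fin (X.c 0)))} :=
        Fintype.card_le_one_iff_subsingleton.1 (by simp)
      rwa [Fintype.sum_subsingleton _ t, smul_eq_mul, mul_one] at hg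
    · have htop : Submodule.span ℤ ((fun _v => (1 : ℤ)) ''
          ((({v} : Finset (Fin (X.c 0)))) : Set (Fin (X.c 0)))) = ⊤ := by
        rw [Finset.coe_singleton, Set.image_singleton]
        exact Ideal.span_singleton_one
      rw [htop, Nat.card_unique]
      exact one_ne_zero
  | succ j =>
    refine isTree_of_linearIndependent
      ((linearIndependent_col_subset_iff _ _).2 fun v hv h => hR v h hv) ?_
    have h := X.finrank_Zker_succ j
    rw [hX.finrank_range hj] at h
    omega

end CellStructure

/-- **Nonsingularity criterion** (Duval–Klivans–Martin, Prop. 2.7).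
Let `d = e + 1 ≥ 1`, let `X` be a `d`-dimensional APC combinatorial cell structure, and
let `T ⊆ X_d`, `S ⊆ X_{d-1}` with `|T| = |S| = |X_d| - β_d(X)`.  Then (for any choice of
indexings of `S` and `T` by `Fin m`) the square submatrix `∂_{S,T}` of `∂_d` with rows `S`
and columns `T` has nonzero determinant if and only if `T` is a cellular spanning `d`-tree
of `X` and the complement `S̄ = X_{d-1} ∖ S` is the set of `(d-1)`-cells of a cellular
spanning `(d-1)`-tree of `X`. -/
theorem nonsingularity_criterion
    (e : ℕ) (X : CellStructure (e + 1)) (hAPC : X.APC)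
    (T : Finset (Fin (X.c (e + 1)))) (S : Finset (Fin (X.c e)))
    (hT : T.card = X.c (e + 1) - X.beta (e + 1)) (hS : S.card = T.card)
    (m : ℕ) (eS : Fin m ≃ {f // f ∈ S}) (eT : Fin m ≃ {f // f ∈ T}) :
    Matrix.det (Matrix.of fun i j => X.D e (eS i).1 (eT j).1) ≠ 0 ↔
      (X.IsTree e T ∧ X.IsTreeG e Sᶜ) := by
  have hsucc := X.finrank_Zker_succ e
  rw [hAPC.finrank_range e.lt_succ_self] at hsucc
  have hTcard : T.card = Module.finrank ℤ (X.Zker e) := by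
    rw [hT, X.beta_top]
    omega
  have hScard : Sᶜ.card + Module.finrank ℤ (X.Zker e) = X.c e := by
    rw [← hTcard, ← hS, Finset.card_compl_add_card, Fintype.card_fin]
  rw [det_submatrix_ne_zero_iff]
  constructor
  · intro h
    have hTree : X.IsTree e T := CellStructure.isTree_of_linearIndependent
      ((linearIndependent_col_subset_iff _ _).2 fun v hv h0 =>
        h v hv fun i _ => congrFun h0 i) hTcard
    refine ⟨hTree, hAPC.isTreeG_of_forall_eq_zero e.le_succ hScard fun w hw hwS => ?_⟩
    obtain ⟨N, hN, hNw⟩ := CellStructure.exists_smul_mem_colSpan hTree.2.1 hw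
    obtain ⟨v, hv, hvw⟩ := X.exists_mulVec_eq_of_mem_colSpan hNw
    have hv0 : v = 0 := h v hv fun i hi => by
      rw [hvw, Pi.smul_apply, hwS i (by simpa using hi), smul_zero]
    rw [hv0, mulVec_zero] at hvw
    exact (smul_eq_zero.1 hvw.symm).resolve_left hN
  · rintro ⟨hTree, hSTree⟩ v hv hvS
    refine (linearIndependent_col_subset_iff _ _).1 hTree.1 v hv ?_
    exact hSTree.eq_zero_of_mem_Zker (X.mulVec_mem_Zker e v) fun i hi =>
      hvS i (by simpa using hi)
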